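/- arXiv:2303.13670 — 6 statements merged into one kernel-verified Lean document; each statement's English description precedes it below -/
import Mathlib

section
/- Let q be a prime power, m ≥ 2, and let A ⊆ ℙ²(F_q) be a set of points containing no m+1 distinct collinear points. Let ℓ be a line of ℙ²(F_q). Then there exists a subset H ⊆ ℓ with |H| ≤ m such that A ∪ H still contains no m+1 distinct collinear points, and every point of ℓ not belonging to A ∪ H is collinear with m distinct points of A ∪ H. -/
/-- A set of points of `ℙ²(F_q)` is *collinear* if all their representative vectors lie in a
common 2-dimensional linear subspace of `F_q³`. -/
def CollinearSet (F : Type*) [Field F]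
    (s : Set (Projectivization F (Fin 3 → F))) : Prop :=
  ∃ W : Submodule F (Fin 3 → F), Module.finrank F W = 2 ∧ ∀ P ∈ s, P.rep ∈ W

/-- Given a set `A ⊆ ℙ²(F_q)` with no `m+1` distinct collinear points (`m ≥ 2`) and a line
`ℓ` (the points whose representatives lie in a 2-dimensional subspace `W`), there is a subset
`H` of `ℓ` of at most `m` points such that `A ∪ H` still has no `m+1` distinct collinear
points, and every point of `ℓ` outside `A ∪ H` is collinear with `m` distinct points of
`A ∪ H`. -/
theorem stmt_3 (F : Type*) [Field F] [Fintype F]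
    [DecidableEq (Projectivization F (Fin 3 → F))]
    (m : ℕ) (hm : 2 ≤ m)
    (A : Finset (Projectivization F (Fin 3 → F)))
    (hA : ∀ B ⊆ A, B.card = m + 1 → ¬ CollinearSet F ↑B)
    (W : Submodule F (Fin 3 → F)) (hW : Module.finrank F W = 2) :
    ∃ H : Finset (Projectivization F (Fin 3 → F)),
      (∀ P ∈ H, P.rep ∈ W) ∧ H.card ≤ m ∧
      (∀ B ⊆ A ∪ H, B.card = m + 1 → ¬ CollinearSet F ↑B) ∧
      (∀ P : Projectivization F (Fin 3 → F), P.rep ∈ W → P ∉ A ∪ H →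
        ∃ B ⊆ A ∪ H, B.card = m ∧ CollinearSet F (insert P ↑B)) := by
  classical
  haveI : Finite (Projectivization F (Fin 3 → F)) := by
    unfold Projectivization
    infer_instance
  let S : Set (Finset (Projectivization F (Fin 3 → F))) :=
    {H | (∀ P ∈ H, P.rep ∈ W) ∧ ∀ B ⊆ A ∪ H, B.card = m + 1 → ¬ CollinearSet F ↑B}
  have hS : S.Nonempty := ⟨∅, by simp, by simpa using hA⟩
  obtain ⟨H, hH⟩ := (Set.toFinite S).exists_maximal hS
  obtain ⟨h1, h2⟩ := hH.prop
  refine ⟨H, h1, ?_, h2, ?_⟩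
  · by_contra hc
    obtain ⟨B, hB, hBc⟩ := Finset.exists_subset_card_eq (show m + 1 ≤ H.card by omega)
    exact h2 B (hB.trans Finset.subset_union_right) hBc ⟨W, hW, fun P hP => h1 P (hB hP)⟩
  · intro P hP hPn
    have hn : insert P H ∉ S := by
      intro hin
      have := hH.le_of_ge hin (Finset.subset_insert P H)
      exact hPn (Finset.mem_union_right _ (this (Finset.mem_insert_self P H)))
    have hex : ∃ B ⊆ A ∪ insert P H, B.card = m + 1 ∧ CollinearSet F ↑B := by
      by_contra hc
      push Not at hc
      refine hn ⟨?_, hc⟩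
      intro Q hQ
      rcases Finset.mem_insert.1 hQ with rfl | hQ
      · exact hP
      · exact h1 Q hQ
    obtain ⟨B, hB, hBc, hcol⟩ := hex
    have hsub : B.erase P ⊆ A ∪ H := by
      intro Q hQ
      have h3 := Finset.mem_erase.1 hQ
      have h4 := hB h3.2
      simp only [Finset.mem_union, Finset.mem_insert] at h4 ⊢
      tauto
    have hPB : P ∈ B := by
      by_contra hPB
      rw [Finset.erase_eq_of_notMem hPB] at hsub
      exact h2 B hsub hBc hcol
    refine ⟨B.erase P, hsub, by rw [Finset.card_erase_of_mem hPB, hBc]; rfl, ?_⟩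
    rw [← Finset.coe_insert, Finset.insert_erase hPB]
    exact hcol
end

section
/- Let p be an odd prime, q a power of p, and m an integer with 3 ≤ m < p. Let f ∈ F_q[x] be a squarefree polynomial of degree m, and let K = F_q(x)[Y]/(Y² − f(x)) be the function field of the hyperelliptic curve y² = f(x), with y the image of Y in K. Then the subfield of K generated over F_q by the two elements f'(x)/(2y) and y − x·f'(x)/(2y) is all of K; that is, F_q( f'/(2y), y − x f'/(2y) ) = F_q(x, y). -/
open scoped TensorProduct in
lemma aux_exists_deriv (F K : Type*) [Field F] [Field K] [Algebra F K]
    [Algebra (Polynomial F) K] [IsScalarTower F (Polynomial F) K]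
    [Algebra.FormallyEtale (Polynomial F) K] :
    ∃ D : Derivation F K K, ∀ P : Polynomial F,
      D (algebraMap (Polynomial F) K P) = algebraMap (Polynomial F) K (Polynomial.derivative P) := by
  let e := (KaehlerDifferential.tensorKaehlerEquivOfFormallyEtale F (Polynomial F) K).symm
  let g : Ω[Polynomial F⁄F] →ₗ[Polynomial F] K :=
    (Algebra.linearMap (Polynomial F) K).comp
      (KaehlerDifferential.polynomialEquiv F).toLinearMap
  let h : K ⊗[Polynomial F] Ω[Polynomial F⁄F] →ₗ[K] K := g.liftBaseChange K
  refine ⟨(h.comp e.toLinearMap).compDer (KaehlerDifferential.D F K), fun P => ?_⟩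
  have h1 : e (KaehlerDifferential.D F K (algebraMap (Polynomial F) K P)) =
      1 ⊗ₜ KaehlerDifferential.D F (Polynomial F) P :=
    KaehlerDifferential.tensorKaehlerEquivOfFormallyEtale_symm_D_algebraMap F (Polynomial F) K P
  change h (e (KaehlerDifferential.D F K (algebraMap (Polynomial F) K P))) = _
  rw [h1]
  simp [h, g]

lemma aux_chain {F K : Type*} [Field F] [Field K] [Algebra F K] (D : Derivation F K K)
    (a : Fin 2 → K) (P : MvPolynomial (Fin 2) F) :
    D (MvPolynomial.aeval a P) =
      ∑ i, MvPolynomial.aeval a (MvPolynomial.pderiv i P) * D (a i) := by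
  induction P using MvPolynomial.induction_on with
  | C c => simp
  | add P Q hP hQ => simp only [map_add, hP, hQ, add_mul, Finset.sum_add_distrib]
  | mul_X P j hP =>
    simp only [map_mul, Derivation.leibniz, hP, MvPolynomial.aeval_X,
      map_add, smul_eq_mul, Fin.sum_univ_two, MvPolynomial.pderiv_X]
    fin_cases j <;> simp <;> ring

lemma aux_totalDegree {F σ : Type*} [Field F] (P : MvPolynomial σ F) (i : σ)
    (h : MvPolynomial.pderiv i P ≠ 0) :
    (MvPolynomial.pderiv i P).totalDegree < P.totalDegree := by
  obtain ⟨m, hm, he⟩ := Finset.exists_mem_eq_sup _ (MvPolynomial.support_nonempty.mpr h)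
    (fun s : σ →₀ ℕ => s.sum fun _ e => e)
  have : (MvPolynomial.pderiv i P).totalDegree = m.sum fun _ e => e := he
  rw [this]
  rw [MvPolynomial.mem_support_iff, MvPolynomial.coeff_pderiv] at hm
  have h2 := MvPolynomial.le_totalDegree
    (MvPolynomial.mem_support_iff.mpr (left_ne_zero_of_mul hm))
  rw [Finsupp.sum_add_index' (by simp) (by simp)] at h2
  simp at h2
  omega

lemma aux_relation {F K : Type*} [Field F] [Field K] [Algebra F K] [PerfectField F] (p : ℕ)
    (hp : p.Prime) [CharP F p] (a : Fin 2 → K) (ha : ¬ AlgebraicIndependent F a) :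
    ∃ P : MvPolynomial (Fin 2) F, MvPolynomial.aeval a P = 0 ∧
      ∃ i, MvPolynomial.aeval a (MvPolynomial.pderiv i P) ≠ 0 := by
  have : Fact p.Prime := ⟨hp⟩
  have : ExpChar F p := .prime hp
  have : CharP K p := .of_ringHom_of_ne_zero (algebraMap F K) p hp.ne_zero
  set S := {P : MvPolynomial (Fin 2) F | P ≠ 0 ∧ MvPolynomial.aeval a P = 0}
  have hS : S.Nonempty := by
    rw [algebraicIndependent_iff] at ha
    push Not at ha
    obtain ⟨P, h1, h2⟩ := ha
    exact ⟨P, h2, h1⟩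
  obtain ⟨P, ⟨hP0, hPa⟩, hmin⟩ := exists_minimalFor_of_wellFoundedLT (· ∈ S)
    MvPolynomial.totalDegree hS
  have hmin' : ∀ Q : MvPolynomial (Fin 2) F, Q ≠ 0 → MvPolynomial.aeval a Q = 0 →
      P.totalDegree ≤ Q.totalDegree := fun Q h1 h2 => by
    rcases le_total P.totalDegree Q.totalDegree with h | h
    · exact h
    · exact hmin ⟨h1, h2⟩ h
  obtain ⟨i, σ, hσ, hi⟩ := MvPolynomial.exists_mem_support_not_dvd_of_forall_totalDegree_le p hp
    (fun s hs ↦ by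
      apply hs.map_of_injective_injective (frobeniusEquiv F p).symm
        (frobenius K p).toAddMonoidHom
      · simp
      · intro z hz
        simpa using hz
      · intro r z
        change ((frobeniusEquiv F p).symm r • z) ^ p = r • z ^ p
        rw [Algebra.smul_def, Algebra.smul_def, mul_pow, ← map_pow]
        congr 2
        exact (frobeniusEquiv F p).apply_symm_apply r)
    hmin' hP0 hPa
  refine ⟨P, hPa, i, fun h0 => ?_⟩
  have hne : MvPolynomial.pderiv i P ≠ 0 := by
    intro h
    have h1 := MvPolynomial.coeff_pderiv (i := i) P (σ - Finsupp.single i 1)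
    have hpos : 1 ≤ σ i := Nat.one_le_iff_ne_zero.mpr (fun h => hi (by simp [h]))
    rw [h, tsub_add_cancel_of_le (by simpa using hpos)] at h1
    rw [MvPolynomial.mem_support_iff] at hσ
    have h2 : ((σ i : ℕ) : F) = 0 := by
      have : (((σ - Finsupp.single i 1 : Fin 2 →₀ ℕ) i : ℕ) : F) + 1 = (σ i : F) := by
        simp [Nat.cast_sub hpos]
      rw [this] at h1
      simpa [hσ] using h1.symm
    exact hi ((CharP.cast_eq_zero_iff F p _).mp h2)
  have := hmin' _ hne h0
  have := aux_totalDegree P i hne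
  omega

lemma aux_poly {F : Type*} [Field F] (p m : ℕ) [CharP F p] (hm : 3 ≤ m) (hmp : m < p)
    (f : Polynomial F) (hdeg : f.natDegree = m)
    (h : 2 * f * Polynomial.derivative (Polynomial.derivative f) = (Polynomial.derivative f) ^ 2) :
    False := by
  obtain ⟨k, rfl⟩ : ∃ k, m = k + 3 := ⟨m - 3, by omega⟩
  have h1 : (Polynomial.derivative f).natDegree ≤ k + 2 := by
    have := Polynomial.natDegree_derivative_le f
    omega
  have h2 : (Polynomial.derivative (Polynomial.derivative f)).natDegree ≤ k + 1 := by
    have := Polynomial.natDegree_derivative_le (Polynomial.derivative f)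
    omega
  have e1 := Polynomial.coeff_mul_add_eq_of_natDegree_le hdeg.le h2
  have e2 := Polynomial.coeff_mul_add_eq_of_natDegree_le h1 h1
  have e3 := congrArg (fun g => Polynomial.coeff g (k + 3 + (k + 1))) h
  have e4 : k + 3 + (k + 1) = k + 2 + (k + 2) := by ring
  have hl : f.coeff (k + 3) ≠ 0 := by
    rw [← hdeg]
    exact Polynomial.leadingCoeff_ne_zero.mpr (by rintro rfl; simp at hdeg)
  rw [mul_assoc, ← Polynomial.C_ofNat, Polynomial.coeff_C_mul, e1, e4, sq, e2] at e3
  simp only [Polynomial.coeff_derivative] at e3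
  push_cast at e3
  have key : f.coeff (k + 3) * (f.coeff (k + 3) * (((k + 3 : ℕ) : F) * ((k + 1 : ℕ) : F))) = 0 := by
    push_cast
    have : k + 1 + 1 + 1 = k + 3 := rfl
    have : k + 2 + 1 = k + 3 := rfl
    simp only [this] at e3
    linear_combination e3
  simp only [mul_eq_zero, hl, false_or, CharP.cast_eq_zero_iff F p] at key
  rcases key with h | h <;> have := Nat.le_of_dvd (by omega) h <;> omega

lemma aux_main {F K : Type*} [Field F] [Finite F] [Field K] [Algebra F K]
    [Algebra (Polynomial F) K] [IsScalarTower F (Polynomial F) K]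
    [Algebra (RatFunc F) K] [IsScalarTower (Polynomial F) (RatFunc F) K]
    (p m : ℕ) (hp : p.Prime) (hodd : p ≠ 2) [CharP F p] (hm : 3 ≤ m) (hmp : m < p)
    (f : Polynomial F) (hdeg : f.natDegree = m) (x y a b : K)
    (hx : x = algebraMap (Polynomial F) K Polynomial.X)
    (hy : y ^ 2 = algebraMap (Polynomial F) K f)
    (ha : a = algebraMap (Polynomial F) K (Polynomial.derivative f) / (2 * y))
    (hb : b = y - x * a)
    (hgen : IntermediateField.adjoin (RatFunc F) {y} = ⊤)
    (L : Subfield K) (hF : ∀ c : F, algebraMap F K c ∈ L) (haL : a ∈ L) (hbL : b ∈ L) :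
    x ∈ L ∧ y ∈ L := by
  have : CharP K p := .of_ringHom_of_ne_zero (algebraMap F K) p hp.ne_zero
  have h2 : (2 : K) ≠ 0 := by
    intro h
    have : ((2 : ℕ) : K) = 0 := by exact_mod_cast h
    rw [CharP.cast_eq_zero_iff K p] at this
    exact hodd ((Nat.prime_dvd_prime_iff_eq hp Nat.prime_two).mp this)
  have hinj : Function.Injective (algebraMap (Polynomial F) K) := by
    rw [IsScalarTower.algebraMap_eq (Polynomial F) (RatFunc F) K]
    exact (algebraMap (RatFunc F) K).injective.comp (IsFractionRing.injective _ _)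
  have hf0 : f ≠ 0 := by rintro rfl; simp at hdeg; omega
  have hy0 : y ≠ 0 := by
    rintro rfl
    apply hf0
    apply hinj
    rw [← hy]; simp
  -- separability
  have hysep : IsSeparable (RatFunc F) y := by
    have hs : (Polynomial.X ^ 2 - Polynomial.C (algebraMap (Polynomial F) (RatFunc F) f)).Separable := by
      apply Polynomial.separable_X_pow_sub_C
      · intro h
        apply h2
        have := congrArg (algebraMap (RatFunc F) K) h
        rw [map_natCast, map_zero] at this
        exact_mod_cast this
      · simpa using hf0
    refine hs.of_dvd (minpoly.dvd _ _ ?_)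
    simp [hy, ← IsScalarTower.algebraMap_apply]
  have hsep : Algebra.IsSeparable (RatFunc F) K := by
    have h1 : Algebra.IsSeparable (RatFunc F) (IntermediateField.adjoin (RatFunc F) {y}) := by
      rw [IntermediateField.isSeparable_adjoin_iff_isSeparable]
      simpa using hysep
    rw [hgen] at h1
    exact Algebra.IsSeparable.of_algHom (RatFunc F) _
      (IntermediateField.topEquiv (F := RatFunc F) (E := K)).symm.toAlgHom
  have : Algebra.FormallyEtale (RatFunc F) K := Algebra.FormallyEtale.of_isSeparable _ _
  have : Algebra.FormallyEtale (Polynomial F) (RatFunc F) :=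
    Algebra.FormallyEtale.of_isLocalization (nonZeroDivisors (Polynomial F))
  have : Algebra.FormallyEtale (Polynomial F) K := .comp _ (RatFunc F) _
  obtain ⟨D, hD⟩ := aux_exists_deriv F K
  have hDx : D x = 1 := by rw [hx, hD]; simp
  have hya : 2 * y * a = algebraMap (Polynomial F) K (Polynomial.derivative f) := by
    rw [ha]; field_simp
  have hDy : D y = a := by
    have := congrArg D hy
    rw [hD, ← hya, sq, Derivation.leibniz, smul_eq_mul] at this
    apply mul_left_cancel₀ (mul_ne_zero h2 hy0)
    linear_combination this
  have hDa : D a ≠ 0 := by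
    intro h0
    have h1 := congrArg D hya
    have hD2 : D (2 : K) = 0 := by exact_mod_cast D.map_natCast 2
    rw [hD] at h1
    simp only [Derivation.leibniz, smul_eq_mul, hD2, hDy, h0] at h1
    apply aux_poly p m hm hmp f hdeg
    apply hinj
    rw [map_pow, map_mul, map_mul, map_ofNat, ← hy, ← h1, ← hya]
    ring
  have hDb : D b = - x * D a := by
    rw [hb, map_sub, Derivation.leibniz, hDy, hDx]
    simp
  -- algebraic dependence
  have hdep : ¬ AlgebraicIndependent F ![a, b] := by
    intro h
    have h1 := h.lift_cardinalMk_le_trdeg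
    have : FaithfulSMul (Polynomial F) K := (faithfulSMul_iff_algebraMap_injective _ _).mpr hinj
    have h3 := lift_trdeg_add_eq F (Polynomial F) K
    have : Algebra.IsAlgebraic (Polynomial F) (RatFunc F) :=
      IsLocalization.isAlgebraic _ (nonZeroDivisors (Polynomial F))
    have : Algebra.IsAlgebraic (RatFunc F) K := inferInstance
    have : Algebra.IsAlgebraic (Polynomial F) K := .trans _ (RatFunc F) _
    rw [Polynomial.trdeg_of_isDomain, trdeg_eq_zero] at h3
    simp at h3
    have h4 : Algebra.trdeg F K = 1 := by
      have := h3.symm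
      simpa using this
    rw [h4] at h1
    simp at h1
  obtain ⟨P, hP, i, hi⟩ := aux_relation p hp ![a, b] hdep
  have hmem : ∀ Q : MvPolynomial (Fin 2) F, MvPolynomial.aeval ![a, b] Q ∈ L := by
    intro Q
    induction Q using MvPolynomial.induction_on with
    | C c => simpa using hF c
    | add Q R hQ hR => simpa using L.add_mem hQ hR
    | mul_X Q j hQ =>
      rw [map_mul]
      refine L.mul_mem hQ ?_
      fin_cases j
      · simpa using haL
      · simpa using hbL
  have hc := aux_chain D ![a, b] P
  rw [hP, map_zero, Fin.sum_univ_two] at hc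
  simp only [Matrix.cons_val_zero, Matrix.cons_val_one, hDb] at hc
  set u := MvPolynomial.aeval ![a, b] (MvPolynomial.pderiv 0 P) with hu
  set v := MvPolynomial.aeval ![a, b] (MvPolynomial.pderiv 1 P) with hv
  have huv : u = x * v := by
    apply mul_right_cancel₀ hDa
    linear_combination -hc
  have hv0 : v ≠ 0 := by
    intro h
    rw [h, mul_zero] at huv
    fin_cases i
    · exact hi huv
    · exact hi h
  have hxL : x ∈ L := by
    have : x = u / v := by rw [huv]; field_simp
    rw [this]
    exact L.div_mem (hmem _) (hmem _)
  refine ⟨hxL, ?_⟩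
  have : y = b + x * a := by rw [hb]; ring
  rw [this]
  exact L.add_mem hbL (L.mul_mem hxL haL)

/-- Let `p` be an odd prime, `q` a power of `p`, `3 ≤ m < p`, and `f ∈ F_q[x]` squarefree of
degree `m`.  Let `K = F_q(x)(y)` be the function field of the hyperelliptic curve `y² = f(x)`
(formalized as an abstract field `K` together with an embedding `ι` of `F_q(x)` and an element
`y` with `y² = f(x)` generating `K` over `F_q(x)`).  Then the subfield of `K` generated over
`F_q` by `f'/(2y)` and `y - x·f'/(2y)` is all of `K = F_q(x, y)`. -/
theorem stmt_4 (F : Type*) [Field F] [Fintype F] (p m : ℕ) (hp : p.Prime) (hodd : p ≠ 2)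
    (hchar : ringChar F = p) (hm : 3 ≤ m) (hmp : m < p)
    (f : Polynomial F) (hsf : Squarefree f) (hdeg : f.natDegree = m)
    (K : Type*) [Field K] (ι : RatFunc F →+* K) (y : K)
    (hy : y ^ 2 = ι (algebraMap (Polynomial F) (RatFunc F) f))
    (hgen : Subfield.closure (Set.range ι ∪ {y}) = ⊤) :
    Subfield.closure
        (Set.range (ι.comp (algebraMap F (RatFunc F))) ∪
          { ι (algebraMap (Polynomial F) (RatFunc F) (Polynomial.derivative f)) / (2 * y),
            y - ι (algebraMap (Polynomial F) (RatFunc F) Polynomial.X) *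
              (ι (algebraMap (Polynomial F) (RatFunc F) (Polynomial.derivative f)) / (2 * y)) }) =
      Subfield.closure
        (Set.range (ι.comp (algebraMap F (RatFunc F))) ∪
          { ι (algebraMap (Polynomial F) (RatFunc F) Polynomial.X), y }) := by
  classical
  have hcp : CharP F p := hchar ▸ ringChar.charP F
  let : Algebra (RatFunc F) K := ι.toAlgebra
  let : Algebra (Polynomial F) K :=
    (ι.comp (algebraMap (Polynomial F) (RatFunc F))).toAlgebra
  let : Algebra F K := (ι.comp (algebraMap F (RatFunc F))).toAlgebra
  have : IsScalarTower (Polynomial F) (RatFunc F) K := .of_algebraMap_eq fun _ => rfl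
  have : IsScalarTower F (Polynomial F) K := .of_algebraMap_eq fun c => by
    change ι (algebraMap F (RatFunc F) c) =
      ι (algebraMap (Polynomial F) (RatFunc F) (algebraMap F (Polynomial F) c))
    rw [← IsScalarTower.algebraMap_apply]
  have hgen' : IntermediateField.adjoin (RatFunc F) {y} = ⊤ := by
    apply IntermediateField.toSubfield_injective
    exact hgen
  apply le_antisymm
  · rw [Subfield.closure_le]
    have hF : ∀ c : F, ι (algebraMap F (RatFunc F) c) ∈ Subfield.closure
        (Set.range (ι.comp (algebraMap F (RatFunc F))) ∪
          { ι (algebraMap (Polynomial F) (RatFunc F) Polynomial.X), y }) := fun c =>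
      Subfield.subset_closure (Or.inl ⟨c, rfl⟩)
    have hX := Subfield.subset_closure (K := K)
      (s := Set.range (ι.comp (algebraMap F (RatFunc F))) ∪
          { ι (algebraMap (Polynomial F) (RatFunc F) Polynomial.X), y }) (Or.inr (Or.inl rfl))
    have hY := Subfield.subset_closure (K := K)
      (s := Set.range (ι.comp (algebraMap F (RatFunc F))) ∪
          { ι (algebraMap (Polynomial F) (RatFunc F) Polynomial.X), y }) (Or.inr (Or.inr rfl))
    generalize Subfield.closure
        (Set.range (ι.comp (algebraMap F (RatFunc F))) ∪
          { ι (algebraMap (Polynomial F) (RatFunc F) Polynomial.X), y }) = L at *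
    have hP : ∀ P : Polynomial F, ι (algebraMap (Polynomial F) (RatFunc F) P) ∈ L := by
      intro P
      induction P using Polynomial.induction_on' with
      | add P Q hP hQ => simpa using L.add_mem hP hQ
      | monomial n c =>
        rw [← Polynomial.C_mul_X_pow_eq_monomial, map_mul, map_mul, map_pow, map_pow]
        refine L.mul_mem ?_ (L.pow_mem hX n)
        have := hF c
        rwa [IsScalarTower.algebraMap_apply F (Polynomial F) (RatFunc F)] at this
    have hA := L.div_mem (hP (Polynomial.derivative f)) (L.mul_mem (ofNat_mem L 2) hY)
    rintro z (⟨c, rfl⟩ | rfl | rfl)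
    · exact hF c
    · exact hA
    · exact L.sub_mem hY (L.mul_mem hX hA)
  · obtain ⟨h1, h2⟩ := aux_main p m hp hodd hm hmp f hdeg
      (ι (algebraMap (Polynomial F) (RatFunc F) Polynomial.X)) y _ _ rfl hy rfl rfl hgen'
      (Subfield.closure
        (Set.range (ι.comp (algebraMap F (RatFunc F))) ∪
          { ι (algebraMap (Polynomial F) (RatFunc F) (Polynomial.derivative f)) / (2 * y),
            y - ι (algebraMap (Polynomial F) (RatFunc F) Polynomial.X) *
              (ι (algebraMap (Polynomial F) (RatFunc F) (Polynomial.derivative f)) / (2 * y)) }))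
      (fun c => Subfield.subset_closure (Or.inl ⟨c, rfl⟩))
      (Subfield.subset_closure (Or.inr (Or.inl rfl)))
      (Subfield.subset_closure (Or.inr (Or.inr rfl)))
    rw [Subfield.closure_le]
    rintro z (⟨c, rfl⟩ | rfl | rfl)
    · exact Subfield.subset_closure (Or.inl ⟨c, rfl⟩)
    · exact h1
    · exact h2
end

section
/- Let p be an odd prime, q a power of p, and m an integer with 3 ≤ m < p. Let f ∈ F_q[x] be squarefree of degree m with x ∣ f, and set u = (x·f' − 2f)²/(4f) ∈ F_q(x). Then [F_q(x) : F_q(u)] = 2m − 1. -/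
section
open Polynomial

theorem stmt_7_aux (F : Type*) [Field F] [Fintype F] (p m : ℕ) (hp : p.Prime) (hodd : p ≠ 2)
    (hchar : ringChar F = p) (hm : 3 ≤ m) (hmp : m < p)
    (f : Polynomial F) (hsf : Squarefree f) (hdeg : f.natDegree = m)
    (hx : Polynomial.X ∣ f) :
    Module.finrank
      (IntermediateField.adjoin F
        ({algebraMap (Polynomial F) (RatFunc F)
              ((Polynomial.X * Polynomial.derivative f - 2 * f) ^ 2) /
            algebraMap (Polynomial F) (RatFunc F) (4 * f)} : Set (RatFunc F)))
      (RatFunc F) = 2 * m - 1 := by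
  classical
  obtain ⟨g, rfl⟩ := hx
  have hg0 : g ≠ 0 := by rintro rfl; simp at hdeg; omega
  have hgdeg : g.natDegree = m - 1 := by
    rw [natDegree_X_mul hg0] at hdeg; omega
  have hcast : ∀ k : ℕ, 0 < k → k < p → (k : F) ≠ 0 := by
    intro k hk hkp h
    have h1 := (ringChar.spec F k).1 h
    rw [hchar] at h1
    exact absurd (Nat.le_of_dvd hk h1) (by omega)
  have h2 : (2 : F) ≠ 0 := by exact_mod_cast hcast 2 (by omega) (by omega)
  have h4 : (4 : F) ≠ 0 := by
    have : (4 : F) = 2 * 2 := by norm_num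
    rw [this]; exact mul_ne_zero h2 h2
  have hXg : IsCoprime (X : F[X]) g := by
    rw [squarefree_mul_iff] at hsf
    exact hsf.1.isCoprime
  have hgg : IsCoprime g (derivative g) := by
    have : g.Separable := PerfectField.separable_iff_squarefree.2
      (hsf.squarefree_of_dvd (Dvd.intro_left _ rfl))
    exact this
  set h : F[X] := X * derivative g - g with hh
  have hhg : IsCoprime h g := by
    have h1 : IsCoprime (X * derivative g) g := hXg.mul_left hgg.symm
    have h3 := h1.add_mul_right_left (-1)
    have e : h = X * derivative g + -1 * g := by rw [hh]; ring
    rw [e]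
    exact h3
  have hco : IsCoprime (X * h ^ 2) (C 4 * g) := by
    have h1 : IsCoprime (X * h ^ 2) g := hXg.mul_left hhg.pow_left
    have h3 : IsUnit (C 4 : F[X]) := isUnit_C.2 (isUnit_iff_ne_zero.2 h4)
    exact (isCoprime_mul_unit_left_right h3 _ _).2 h1
  have hcoef : h.coeff (m - 1) ≠ 0 := by
    have e : m - 1 = (m - 2) + 1 := by omega
    have hc : h.coeff (m - 1) = ((m - 2 : ℕ) : F) * g.coeff (m - 1) := by
      rw [hh, coeff_sub, e, coeff_X_mul, coeff_derivative]
      ring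
    rw [hc]
    refine mul_ne_zero (hcast _ (by omega) (by omega)) ?_
    rw [← hgdeg]
    exact leadingCoeff_ne_zero.2 hg0
  have hhle : h.natDegree ≤ m - 1 := by
    refine (natDegree_sub_le _ _).trans (max_le ?_ hgdeg.le)
    refine natDegree_mul_le.trans ?_
    have := natDegree_derivative_le g
    rw [natDegree_X]; omega
  have hhdeg : h.natDegree = m - 1 := le_antisymm hhle (le_natDegree_of_ne_zero hcoef)
  have hh0 : h ≠ 0 := by intro h0; rw [h0] at hcoef; simp at hcoef
  have hN0 : X * h ^ 2 ≠ 0 := mul_ne_zero X_ne_zero (pow_ne_zero _ hh0)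
  have hD0 : C 4 * g ≠ 0 := mul_ne_zero (C_ne_zero.2 h4) hg0
  have hu : algebraMap F[X] (RatFunc F) ((X * derivative (X * g) - 2 * (X * g)) ^ 2) /
            algebraMap F[X] (RatFunc F) (4 * (X * g)) =
      algebraMap F[X] (RatFunc F) (X * h ^ 2) / algebraMap F[X] (RatFunc F) (C 4 * g) := by
    have e1 : (X * derivative (X * g) - 2 * (X * g)) ^ 2 = X * (X * h ^ 2) := by
      rw [hh, derivative_mul, derivative_X]; ring
    have e2 : (4 * (X * g) : F[X]) = X * (C 4 * g) := by
      have : (C 4 : F[X]) = 4 := rfl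
      rw [this]; ring
    rw [e1, e2, map_mul _ X (X * h ^ 2), map_mul _ X (C 4 * g)]
    refine mul_div_mul_left _ _ ?_
    exact RatFunc.algebraMap_ne_zero X_ne_zero
  rw [hu, RatFunc.finrank_eq_max_natDegree]
  have hgcd : gcd (X * h ^ 2) (C 4 * g) = 1 := by
    rw [← normalize_gcd]
    exact normalize_eq_one.2 ((gcd_isUnit_iff _ _).2 hco)
  have hDl : (C 4 * g).leadingCoeff⁻¹ ≠ 0 := inv_ne_zero (leadingCoeff_ne_zero.2 hD0)
  rw [RatFunc.num_div, RatFunc.denom_div _ hD0, hgcd]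
  simp only [EuclideanDomain.div_one]
  rw [natDegree_C_mul hDl, natDegree_C_mul hDl, natDegree_C_mul h4, natDegree_X_mul (pow_ne_zero _ hh0),
    natDegree_pow, hhdeg, hgdeg]
  omega

end

/-- Let `p` be an odd prime, `q` a power of `p`, `3 ≤ m < p`, and `f ∈ F_q[x]` squarefree of
degree `m` with `x ∣ f`.  Setting `u = (x·f' - 2f)²/(4f) ∈ F_q(x)`, the extension
`F_q(x)/F_q(u)` has degree exactly `2m - 1`. -/
theorem stmt_7 (F : Type*) [Field F] [Fintype F] (p m : ℕ) (hp : p.Prime) (hodd : p ≠ 2)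
    (hchar : ringChar F = p) (hm : 3 ≤ m) (hmp : m < p)
    (f : Polynomial F) (hsf : Squarefree f) (hdeg : f.natDegree = m)
    (hx : Polynomial.X ∣ f) :
    Module.finrank
      (IntermediateField.adjoin F
        ({algebraMap (Polynomial F) (RatFunc F)
              ((Polynomial.X * Polynomial.derivative f - 2 * f) ^ 2) /
            algebraMap (Polynomial F) (RatFunc F) (4 * f)} : Set (RatFunc F)))
      (RatFunc F) = 2 * m - 1 := by
  exact stmt_7_aux F p m hp hodd hchar hm hmp f hsf hdeg hx
end

section
/- Let p be a prime, q a power of p, and let f ∈ F_q[x] be a polynomial whose derivative f' does not belong to F_q[x^p] (i.e. there is no g ∈ F_q[x] with f'(x) = g(x^p); equivalently f'' ≠ 0). Then the subfield of F_q(x) generated over F_q by the two elements f' and x^p·(f')^p − x·f' + f is all of F_q(x). -/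
open Polynomial IntermediateField in
lemma aux_clear {F L : Type*} [Field F] [Field L] [Algebra F L] (a : L) (P : F⟮a⟯[X]) :
    ∃ s : F[X], ∃ G : F[X][X], aeval (AdjoinSimple.gen F a) s ≠ 0 ∧
      G.map (aeval (R := F) (AdjoinSimple.gen F a)).toRingHom =
        C (aeval (AdjoinSimple.gen F a) s) * P := by
  induction P using Polynomial.induction_on' with
  | add P Q hP hQ =>
    obtain ⟨s, G, hs, hG⟩ := hP
    obtain ⟨t, H, ht, hH⟩ := hQ
    refine ⟨s * t, C t * G + C s * H, by simpa using ⟨hs, ht⟩, ?_⟩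
    simp only [Polynomial.map_add, Polynomial.map_mul, hG, hH, Polynomial.map_C, map_mul]
    simp only [AlgHom.toRingHom_eq_coe, RingHom.coe_coe]
    ring
  | monomial n c =>
    obtain ⟨r, s, h⟩ := (mem_adjoin_simple_iff F (c : L)).1 c.2
    have key : ∀ r : F[X], ((aeval (AdjoinSimple.gen F a) r : F⟮a⟯) : L) = aeval a r := by
      intro r
      have := aeval_algebraMap_apply L (AdjoinSimple.gen F a) r
      simpa using this.symm
    by_cases hs : aeval a s = 0
    · refine ⟨1, 0, by simp, ?_⟩
      have : c = 0 := by
        ext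
        simp [h, hs]
      simp [this]
    · refine ⟨s, Polynomial.monomial n r, ?_, ?_⟩
      · intro h0
        apply hs
        rw [← key, h0]; rfl
      · rw [Polynomial.map_monomial, C_mul_monomial]
        congr 1
        ext
        simp only [AlgHom.toRingHom_eq_coe, RingHom.coe_coe, IntermediateField.coe_mul, key, h]
        field_simp

open Polynomial in
lemma aux_deriv {F : Type*} [Field F] (u v : F[X]) (G : F[X][X]) :
    ∃ H : F[X][X], derivative (G.eval₂ (aeval (R := F) u).toRingHom v) =
      H.eval₂ (aeval (R := F) u).toRingHom v * derivative u +
      (derivative G).eval₂ (aeval (R := F) u).toRingHom v * derivative v := by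
  induction G using Polynomial.induction_on' with
  | add P Q hP hQ =>
    obtain ⟨H1, h1⟩ := hP
    obtain ⟨H2, h2⟩ := hQ
    refine ⟨H1 + H2, ?_⟩
    simp only [eval₂_add, derivative_add, h1, h2]
    ring
  | monomial n c =>
    refine ⟨Polynomial.monomial n (derivative c), ?_⟩
    have : derivative (aeval u c) = aeval u (derivative c) * derivative u := by
      rw [← comp_eq_aeval, ← comp_eq_aeval, derivative_comp, mul_comm]
    simp only [eval₂_monomial, derivative_monomial, derivative_mul, derivative_pow, map_mul,
      AlgHom.toRingHom_eq_coe, RingHom.coe_coe, this, map_natCast]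
    ring

open Polynomial in
lemma aux_mem {F L : Type*} [Field F] [Field L] [Algebra F L] (K : IntermediateField F L)
    (φ : F[X] →ₐ[F] L) (u v : F[X]) (hu : φ u ∈ K) (hv : φ v ∈ K) (G : F[X][X]) :
    φ (G.eval₂ (aeval (R := F) u).toRingHom v) ∈ K := by
  induction G using Polynomial.induction_on' with
  | add P Q hP hQ =>
    rw [eval₂_add, map_add]; exact add_mem hP hQ
  | monomial n c =>
    rw [eval₂_monomial, map_mul, map_pow]
    refine mul_mem ?_ (pow_mem hv n)
    simp only [AlgHom.toRingHom_eq_coe, RingHom.coe_coe]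
    rw [← aeval_algHom_apply]
    have := (aeval (R := F) (⟨φ u, hu⟩ : K) c).2
    have h2 := aeval_algebraMap_apply L (⟨φ u, hu⟩ : K) c
    simp only [IntermediateField.algebraMap_apply] at h2
    rw [h2]; exact this

open Polynomial IntermediateField in
lemma aux_sep {F : Type*} [Field F] (u : F[X]) (hu : derivative u ≠ 0) (y : RatFunc F) :
    IsSeparable F⟮algebraMap F[X] (RatFunc F) u⟯ y := by
  set a := algebraMap F[X] (RatFunc F) u with ha
  have hX : IsSeparable F⟮a⟯ (RatFunc.X : RatFunc F) := by
    let P : F⟮a⟯[X] := u.map (algebraMap F F⟮a⟯) - C (AdjoinSimple.gen F a)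
    have hev : ∀ w : F[X], aeval (RatFunc.X : RatFunc F) w = algebraMap F[X] (RatFunc F) w := by
      intro w
      rw [← RatFunc.algebraMap_X, aeval_algebraMap_apply, aeval_X_left_apply]
    have hP : aeval (RatFunc.X : RatFunc F) P = 0 := by
      simp only [P, map_sub, aeval_map_algebraMap, aeval_C, hev]
      simp [ha]
    have hP' : aeval (RatFunc.X : RatFunc F) (derivative P) ≠ 0 := by
      simp only [P, derivative_sub, derivative_C, sub_zero, derivative_map, aeval_map_algebraMap,
        hev]
      intro h
      exact hu ((map_eq_zero_iff _ (RatFunc.algebraMap_injective F)).1 h)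
    have hP0 : P ≠ 0 := by
      rintro h; apply hP'; simp [h]
    have hint : IsIntegral F⟮a⟯ (RatFunc.X : RatFunc F) :=
      isAlgebraic_iff_isIntegral.1 ⟨P, hP0, hP⟩
    unfold IsSeparable
    rw [separable_iff_derivative_ne_zero (minpoly.irreducible hint)]
    intro h
    obtain ⟨Q, hQ⟩ := minpoly.dvd _ _ hP
    apply hP'
    rw [hQ, derivative_mul, h]
    simp
  have h1 : F⟮a⟯⟮(RatFunc.X : RatFunc F)⟯ ≤ separableClosure F⟮a⟯ (RatFunc F) := by
    rw [adjoin_simple_le_iff, mem_separableClosure_iff]; exact hX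
  rw [← mem_separableClosure_iff]
  apply h1
  rw [RatFunc.IntermediateField.adjoin_X]
  trivial

/-- Let `q` be a power of the prime `p` and `f ∈ F_q[x]` with `f' ∉ F_q[x^p]` (i.e. `f'` is
not of the form `g(x^p)`).  Then the subfield of `F_q(x)` generated over `F_q` by `f'` and
`x^p·(f')^p - x·f' + f` is all of `F_q(x)`. -/
theorem stmt_10 (F : Type*) [Field F] [Fintype F] (p : ℕ) (hp : p.Prime)
    (hchar : ringChar F = p) (f : Polynomial F)
    (hf' : ¬ ∃ g : Polynomial F, Polynomial.derivative f = Polynomial.expand F p g) :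
    IntermediateField.adjoin F
        ({algebraMap (Polynomial F) (RatFunc F) (Polynomial.derivative f),
          algebraMap (Polynomial F) (RatFunc F)
            (Polynomial.X ^ p * (Polynomial.derivative f) ^ p -
              Polynomial.X * Polynomial.derivative f + f)} : Set (RatFunc F)) = ⊤ := by
  subst hchar
  have hu : Polynomial.derivative (Polynomial.derivative f) ≠ 0 := fun h =>
    hf' ⟨_, (Polynomial.expand_contract (ringChar F) h hp.ne_zero).symm⟩
  set u := Polynomial.derivative f with hudef
  set v := Polynomial.X ^ ringChar F * u ^ ringChar F - Polynomial.X * u + f with hvdef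
  have hv' : Polynomial.derivative v = - (Polynomial.X * Polynomial.derivative u) := by
    rw [hvdef, ← mul_pow, Polynomial.derivative_add, Polynomial.derivative_sub,
      Polynomial.derivative_pow, Polynomial.derivative_mul, ← hudef]
    simp
  set K := IntermediateField.adjoin F
        ({algebraMap (Polynomial F) (RatFunc F) u,
          algebraMap (Polynomial F) (RatFunc F) v} : Set (RatFunc F)) with hK
  let φ : Polynomial F →ₐ[F] RatFunc F := IsScalarTower.toAlgHom F (Polynomial F) (RatFunc F)
  have hφ : Function.Injective φ := RatFunc.algebraMap_injective F
  have huK : φ u ∈ K := IntermediateField.subset_adjoin _ _ (by simp [φ])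
  have hvK : φ v ∈ K := IntermediateField.subset_adjoin _ _ (by simp [φ])
  have hsep := aux_sep u hu (φ v)
  set a := algebraMap (Polynomial F) (RatFunc F) u with ha
  obtain ⟨s, G, hs, hG⟩ := aux_clear a (minpoly (IntermediateField.adjoin F {a}) (φ v))
  have hcompat : ∀ G : Polynomial (Polynomial F),
      φ (G.eval₂ (Polynomial.aeval (R := F) u).toRingHom v) =
      Polynomial.aeval (φ v)
        (G.map (Polynomial.aeval (R := F)
          (IntermediateField.AdjoinSimple.gen F a)).toRingHom) := by
    intro G
    rw [Polynomial.aeval_def, Polynomial.eval₂_map]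
    have h1 := Polynomial.hom_eval₂ G (Polynomial.aeval (R := F) u).toRingHom φ.toRingHom v
    refine h1.trans ?_
    refine congrArg (fun r => Polynomial.eval₂ r (φ v) G) ?_
    ext x
    · simp [φ]
    · simp [φ, ha]
  have hG0 : G.eval₂ (Polynomial.aeval (R := F) u).toRingHom v = 0 := by
    apply hφ
    rw [hcompat, hG]
    simp
  have hG1 : (Polynomial.derivative G).eval₂ (Polynomial.aeval (R := F) u).toRingHom v ≠ 0 := by
    intro h
    have h2 := hcompat (Polynomial.derivative G)
    rw [h, map_zero, ← Polynomial.derivative_map, hG, Polynomial.derivative_C_mul, map_mul,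
      Polynomial.aeval_C] at h2
    rcases mul_eq_zero.1 h2.symm with h3 | h3
    · exact hs ((map_eq_zero _).1 h3)
    · exact hsep.aeval_derivative_ne_zero (minpoly.aeval _ _) h3
  obtain ⟨H, hH⟩ := aux_deriv u v G
  rw [hG0, Polynomial.derivative_zero, hv'] at hH
  have hX : H.eval₂ (Polynomial.aeval (R := F) u).toRingHom v =
      Polynomial.X * (Polynomial.derivative G).eval₂ (Polynomial.aeval (R := F) u).toRingHom v := by
    apply mul_right_cancel₀ hu
    linear_combination -hH
  have h4 := aux_mem K φ u v huK hvK H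
  have h5 := aux_mem K φ u v huK hvK (Polynomial.derivative G)
  rw [hX, map_mul] at h4
  have hne : φ ((Polynomial.derivative G).eval₂ (Polynomial.aeval (R := F) u).toRingHom v) ≠ 0 :=
    fun h => hG1 ((map_eq_zero_iff φ hφ).1 h)
  have hXK : (RatFunc.X : RatFunc F) ∈ K := by
    have h6 := div_mem h4 h5
    rw [mul_div_cancel_right₀ _ hne] at h6
    simpa [φ] using h6
  rw [eq_top_iff, ← RatFunc.adjoin_X, IntermediateField.adjoin_simple_le_iff]
  exact hXK
end

section
/- Let p be a prime, q a power of p, and f ∈ F_q[x] a polynomial such that the polynomial Y^p − Y − f(x) is irreducible over F_q(x) and such that f' ∉ F_q[x^p]. Let K = F_q(x)[Y]/(Y^p − Y − f(x)) be the Artin–Schreier function field, with y the image of Y in K. Then the subfield of K generated over F_q by f'(x) and x·f'(x) + y is all of K; that is, F_q( f', x f' + y ) = F_q(x, y). -/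
open Polynomial IntermediateField

theorem aux_mem_s11 {R A : Type*} [CommRing R] [CommRing A] [Algebra R A] (S : Subalgebra R A)
    {s : A} (hs : s ∈ S) (P : R[X]) : aeval s P ∈ S :=
  Algebra.adjoin_le (Set.singleton_subset_iff.2 hs) (aeval_mem_adjoin_singleton R s)

theorem aux_sep_s11 {E K : Type*} [Field E] [Field K] [Algebra E K] (s : K) (P : E[X])
    (h0 : aeval s P = 0) (h1 : aeval s (derivative P) ≠ 0) : IsSeparable E s := by
  have hP : P ≠ 0 := by rintro rfl; simp at h1
  have hint : IsIntegral E s := isAlgebraic_iff_isIntegral.1 ⟨P, hP, h0⟩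
  unfold IsSeparable
  rw [separable_iff_derivative_ne_zero (minpoly.irreducible hint)]
  intro hd
  obtain ⟨Q, rfl⟩ := minpoly.dvd E s h0
  apply h1
  simp [derivative_mul, hd]

theorem aux_adj {F K M : Type*} [Field F] [Field K] [Algebra F K] [AddCommGroup M]
    [Module F M] [Module K M] (D : Derivation F K M) (u e : K) (he : e ∈ F⟮u⟯) :
    ∃ a ∈ F⟮u⟯, D e = a • D u := by
  induction he using IntermediateField.adjoin_induction with
  | mem x hx =>
    obtain rfl : x = u := hx
    exact ⟨1, one_mem _, by simp⟩
  | algebraMap x => exact ⟨0, zero_mem _, by simp⟩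
  | add x y hx hy h1 h2 =>
    obtain ⟨a, ha, h1⟩ := h1
    obtain ⟨b, hb, h2⟩ := h2
    exact ⟨a + b, add_mem ha hb, by rw [map_add, h1, h2, add_smul]⟩
  | inv x hx h1 =>
    obtain ⟨a, ha, h1⟩ := h1
    refine ⟨-x⁻¹ ^ 2 * a, mul_mem (neg_mem (pow_mem (inv_mem hx) _)) ha, ?_⟩
    rw [Derivation.leibniz_inv, h1, smul_smul]
  | mul x y hx hy h1 h2 =>
    obtain ⟨a, ha, h1⟩ := h1
    obtain ⟨b, hb, h2⟩ := h2
    exact ⟨x * b + y * a, add_mem (mul_mem hx hb) (mul_mem hy ha), by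
      rw [Derivation.leibniz, h1, h2, add_smul, smul_smul, smul_smul]⟩

theorem aux_poly_s11 {F K M : Type*} [Field F] [Field K] [Algebra F K] [AddCommGroup M]
    [Module F M] [Module K M] (D : Derivation F K M) (u s : K) (L : IntermediateField F K)
    (hE : F⟮u⟯ ≤ L) (hs : s ∈ L) (Q : F⟮u⟯[X]) :
    aeval s Q ∈ L ∧ ∃ a ∈ L, D (aeval s Q) = aeval s (derivative Q) • D s + a • D u := by
  induction Q using Polynomial.induction_on' with
  | add P Q h1 h2 =>
    obtain ⟨h1', a, ha, h1⟩ := h1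
    obtain ⟨h2', b, hb, h2⟩ := h2
    refine ⟨by rw [map_add]; exact add_mem h1' h2', a + b, add_mem ha hb, ?_⟩
    simp only [map_add, h1, h2, add_smul]
    abel
  | monomial n c =>
    obtain ⟨a, ha, h⟩ := aux_adj D u c c.2
    have hc : (c : K) ∈ L := hE c.2
    have e : aeval s (monomial n c) = (c : K) * s ^ n := by
      rw [aeval_monomial]; rfl
    refine ⟨by rw [e]; exact mul_mem hc (pow_mem hs n), s ^ n * a,
      mul_mem (pow_mem hs n) (hE ha), ?_⟩
    have e2 : aeval s (derivative (monomial n c)) = (c : K) * n * s ^ (n - 1) := by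
      rw [derivative_monomial, aeval_monomial, map_mul, map_natCast]; rfl
    rw [e, e2, Derivation.leibniz, h, Derivation.leibniz_pow, ← Nat.cast_smul_eq_nsmul K,
      smul_smul, smul_smul, smul_smul, mul_assoc]

theorem aux_main_s11 {F K M : Type*} [Field F] [Field K] [Algebra F K] [AddCommGroup M]
    [Module F M] [Module K M] (D : Derivation F K M) (u s : K) (L : IntermediateField F K)
    (hE : F⟮u⟯ ≤ L) (hs : s ∈ L) (hsep : IsSeparable F⟮u⟯ s) :
    ∃ a ∈ L, D s = a • D u := by
  obtain ⟨-, a, ha, h⟩ := aux_poly_s11 D u s L hE hs (minpoly F⟮u⟯ s)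
  have hm := (aux_poly_s11 D u s L hE hs (derivative (minpoly F⟮u⟯ s))).1
  have hne : aeval s (derivative (minpoly F⟮u⟯ s)) ≠ 0 :=
    hsep.aeval_derivative_ne_zero (minpoly.aeval _ _)
  set m := aeval s (derivative (minpoly F⟮u⟯ s))
  rw [minpoly.aeval, map_zero] at h
  refine ⟨-(m⁻¹ * a), neg_mem (mul_mem (inv_mem hm) ha), ?_⟩
  have h3 : m • D s = -(a • D u) := eq_neg_of_add_eq_zero_left h.symm
  rw [neg_smul, mul_smul, ← smul_neg, ← h3, smul_smul, inv_mul_cancel₀ hne, one_smul]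

theorem aux_final {F K : Type*} [Field F] [Field K] [Algebra F K] (p : ℕ) [CharP K p]
    (hp : p ≠ 0) (f : F[X]) (x y : K) (hx : Transcendental F x)
    (hf : derivative (derivative f) ≠ 0) (hy : y ^ p - y = aeval x f)
    (hgen : F⟮x, y⟯ = ⊤) :
    x ∈ F⟮aeval x (derivative f), x * aeval x (derivative f) + y⟯ := by
  set u := aeval x (derivative f) with hu
  set v := x * u + y with hv
  set L := F⟮u, v⟯ with hL
  have huL : u ∈ L := subset_adjoin F _ (by simp)
  have hvL : v ∈ L := subset_adjoin F _ (by simp)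
  have hE : F⟮u⟯ ≤ L := by
    rw [adjoin_simple_le_iff]; exact huL
  have hxs : IsSeparable F⟮u⟯ x := by
    apply aux_sep_s11 x ((derivative f).map (algebraMap F F⟮u⟯) - C (AdjoinSimple.gen F u))
    · rw [map_sub, aeval_map_algebraMap, aeval_C, AdjoinSimple.algebraMap_gen, sub_self]
    · rw [derivative_sub, derivative_C, sub_zero, derivative_map, aeval_map_algebraMap]
      exact fun h => hf (transcendental_iff.1 hx _ h)
  have hxS : x ∈ separableClosure F⟮u⟯ K := mem_separableClosure_iff.2 hxs
  have hfS : aeval x f ∈ separableClosure F⟮u⟯ K := by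
    have : aeval x (f.map (algebraMap F F⟮u⟯)) ∈ separableClosure F⟮u⟯ K :=
      aux_mem_s11 (separableClosure F⟮u⟯ K).toSubalgebra hxS _
    rwa [aeval_map_algebraMap] at this
  have hys : IsSeparable F⟮u⟯ y := by
    have : IsSeparable (separableClosure F⟮u⟯ K) y := by
      apply aux_sep_s11 y (X ^ p - X - C (⟨_, hfS⟩ : separableClosure F⟮u⟯ K))
      · simp only [map_sub, map_pow, aeval_X, aeval_C, hy]
        exact sub_self _
      · have : (p : separableClosure F⟮u⟯ K) = 0 := by
          apply Subtype.ext
          simp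
        simp [derivative_X_pow, this]
    exact IsSeparable.of_algebra_isSeparable_of_isSeparable F⟮u⟯ this
  have hvs : IsSeparable F⟮u⟯ v := by
    rw [← mem_separableClosure_iff] at hys ⊢
    have : u ∈ separableClosure F⟮u⟯ K := (separableClosure F⟮u⟯ K).algebraMap_mem
      (AdjoinSimple.gen F u)
    exact add_mem (mul_mem hxS this) hys
  let D := KaehlerDifferential.D F K
  have hDy : D y = - (u • D x) := by
    have h := congrArg D hy
    rw [map_sub, Derivation.leibniz_pow, ← Nat.cast_smul_eq_nsmul K, CharP.cast_eq_zero, zero_smul,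
      zero_sub, Derivation.map_aeval] at h
    rw [← h, neg_neg]
  have hDv : D v = x • D u := by
    rw [hv, map_add, Derivation.leibniz, hDy]; abel
  obtain ⟨a, ha, h⟩ := aux_main_s11 D u v L hE hvL hvs
  have h0 : (x - a) • D u = 0 := by rw [sub_smul, ← hDv, h, sub_self]
  by_cases hxa : x - a = 0
  · rw [sub_eq_zero.1 hxa]; exact ha
  exfalso
  have hDu : D u = 0 := by
    have := congrArg ((x - a)⁻¹ • ·) h0
    simpa [smul_smul, inv_mul_cancel₀ hxa] using this
  obtain ⟨b, -, hb⟩ := aux_main_s11 D u x ⊤ le_top trivial hxs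
  rw [hDu, smul_zero] at hb
  rw [hb, smul_zero, neg_zero] at hDy
  have hD : ∀ z, D z = 0 := by
    intro z
    have hz : z ∈ F⟮x, y⟯ := by rw [hgen]; trivial
    induction hz using IntermediateField.adjoin_induction with
    | mem w hw =>
      rcases hw with rfl | rfl
      · exact hb
      · exact hDy
    | algebraMap w => simp
    | add _ _ _ _ h1 h2 => rw [map_add, h1, h2, add_zero]
    | inv _ _ h1 => rw [Derivation.leibniz_inv, h1, smul_zero]
    | mul _ _ _ _ h1 h2 => rw [Derivation.leibniz, h1, h2, smul_zero, smul_zero, add_zero]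
  have hsub : Subsingleton (Ω[K⁄F]) := by
    rw [← Submodule.subsingleton_iff K]
    apply subsingleton_of_bot_eq_top
    rw [← KaehlerDifferential.span_range_derivation, eq_comm, Submodule.span_eq_bot]
    rintro _ ⟨z, rfl⟩
    exact hD z
  have hunr : Algebra.FormallyUnramified F K := ⟨hsub⟩
  have : Algebra.EssFiniteType F K := by
    rw [← IntermediateField.fg_top_iff, ← hgen]
    exact IntermediateField.fg_adjoin_of_finite (Set.toFinite _)
  have : Algebra.IsSeparable F K := (Algebra.FormallyUnramified.iff_isSeparable F K).1 hunr
  exact hx (Algebra.IsAlgebraic.isAlgebraic x)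


/-- Let `q` be a power of the prime `p` and `f ∈ F_q[x]` such that `Y^p - Y - f(x)` is
irreducible over `F_q(x)` and `f' ∉ F_q[x^p]`.  Let `K = F_q(x)(y)` be the Artin–Schreier
function field, i.e. `y^p - y = f(x)` (formalized as an abstract field `K` with an embedding
`ι` of `F_q(x)` and an element `y` with `y^p - y = f(x)` generating `K` over `F_q(x)`).
Then the subfield of `K` generated over `F_q` by `f'` and `x·f' + y` is all of
`K = F_q(x, y)`. -/
theorem stmt_11 (F : Type*) [Field F] [Fintype F] (p : ℕ) (hp : p.Prime)
    (hchar : ringChar F = p) (f : Polynomial F)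
    (hirr : Irreducible (Polynomial.X ^ p - Polynomial.X -
      Polynomial.C (algebraMap (Polynomial F) (RatFunc F) f) : Polynomial (RatFunc F)))
    (hf' : ¬ ∃ g : Polynomial F, Polynomial.derivative f = Polynomial.expand F p g)
    (K : Type*) [Field K] (ι : RatFunc F →+* K) (y : K)
    (hy : y ^ p - y = ι (algebraMap (Polynomial F) (RatFunc F) f))
    (hgen : Subfield.closure (Set.range ι ∪ {y}) = ⊤) :
    Subfield.closure
        (Set.range (ι.comp (algebraMap F (RatFunc F))) ∪
          { ι (algebraMap (Polynomial F) (RatFunc F) (Polynomial.derivative f)),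
            ι (algebraMap (Polynomial F) (RatFunc F) Polynomial.X) *
                ι (algebraMap (Polynomial F) (RatFunc F) (Polynomial.derivative f)) + y }) =
      ⊤ := by

  set ψ : F →+* K := ι.comp (algebraMap F (RatFunc F)) with hψ
  letI : Algebra F K := ψ.toAlgebra
  haveI : CharP F p := hchar ▸ ringChar.charP F
  haveI : CharP K p := charP_of_injective_ringHom ψ.injective p
  set x : K := ι (algebraMap (Polynomial F) (RatFunc F) Polynomial.X) with hx
  have hae : ∀ g : Polynomial F, ι (algebraMap (Polynomial F) (RatFunc F) g) = aeval x g := by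
    intro g
    have : (ι.comp (algebraMap (Polynomial F) (RatFunc F))) = (aeval x : F[X] →ₐ[F] K).toRingHom := by
      apply Polynomial.ringHom_ext
      · intro a
        simp [RingHom.algebraMap_toAlgebra, hψ]
      · simp [hx]
    exact RingHom.congr_fun this g
  have hcl : ∀ S : Set K, (Subfield.closure (Set.range ψ ∪ S) = (IntermediateField.adjoin F S).toSubfield) := by
    intro S; rfl
  have htr : Transcendental F x := by
    rw [transcendental_iff]
    intro g hg
    rw [← hae, map_eq_zero] at hg
    exact (map_eq_zero_iff _ (IsFractionRing.injective F[X] (RatFunc F))).1 hg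
  have htop : F⟮x, y⟯ = ⊤ := by
    have hxm : x ∈ F⟮x, y⟯ := subset_adjoin F _ (by simp)
    have hpm : ∀ g : F[X], aeval x g ∈ F⟮x, y⟯ := fun g =>
      aux_mem_s11 (F⟮x, y⟯).toSubalgebra hxm g
    have : Subfield.closure (Set.range ι ∪ {y}) ≤ F⟮x, y⟯.toSubfield := by
      rw [Subfield.closure_le]
      rintro _ (⟨r, rfl⟩ | rfl)
      · rw [← RatFunc.num_div_denom r, map_div₀, hae, hae]
        exact div_mem (hpm _) (hpm _)
      · exact subset_adjoin F _ (by simp)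
    rw [hgen] at this
    exact eq_top_iff.2 fun z _ => this trivial
  rw [hae f] at hy
  have hf2 : derivative (derivative f) ≠ 0 := fun h =>
    hf' ⟨_, (expand_contract p h hp.ne_zero).symm⟩
  have key := aux_final p hp.ne_zero f x y htr hf2 hy htop
  rw [hae, hcl]
  set u := aeval x (derivative f)
  have huL : u ∈ F⟮u, x * u + y⟯ := subset_adjoin F _ (by simp)
  have hvL : x * u + y ∈ F⟮u, x * u + y⟯ := subset_adjoin F _ (by simp)
  have hyL : y ∈ F⟮u, x * u + y⟯ := by
    have := sub_mem hvL (mul_mem key huL)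
    rwa [add_sub_cancel_left] at this
  have : F⟮x, y⟯ ≤ F⟮u, x * u + y⟯ := by
    rw [adjoin_le_iff]
    rintro _ (rfl | rfl)
    · exact key
    · exact hyL
  rw [htop, top_le_iff] at this
  rw [this]
  rfl
end

section
/- Let p be an odd prime, q a power of p, f ∈ F_q[x], and x₀ ∈ F_q. Consider the polynomial F(t) = −(f'(x₀))^p · t^p + f'(x₀) · t + f(x₀) − f(x₀ + t) ∈ F_q[t]. Then t² always divides F(t), and t³ divides F(t) if and only if f''(x₀) = 0. -/
/-- Let `p` be an odd prime, `q` a power of `p`, `f ∈ F_q[x]` and `x₀ ∈ F_q`.  For the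
polynomial `F(t) = -(f'(x₀))^p·t^p + f'(x₀)·t + f(x₀) - f(x₀ + t)`, we always have
`t² ∣ F(t)`, and `t³ ∣ F(t)` if and only if `f''(x₀) = 0`. -/
theorem stmt_13 (F : Type*) [Field F] [Fintype F] (p : ℕ) (hp : p.Prime) (hodd : p ≠ 2)
    (hchar : ringChar F = p) (f : Polynomial F) (x₀ : F) :
    (Polynomial.X ^ 2 ∣
        (-Polynomial.C ((Polynomial.derivative f).eval x₀ ^ p) * Polynomial.X ^ p +
          Polynomial.C ((Polynomial.derivative f).eval x₀) * Polynomial.X +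
          Polynomial.C (f.eval x₀) - f.comp (Polynomial.C x₀ + Polynomial.X))) ∧
      ((Polynomial.X ^ 3 ∣
          (-Polynomial.C ((Polynomial.derivative f).eval x₀ ^ p) * Polynomial.X ^ p +
            Polynomial.C ((Polynomial.derivative f).eval x₀) * Polynomial.X +
            Polynomial.C (f.eval x₀) - f.comp (Polynomial.C x₀ + Polynomial.X))) ↔
        (Polynomial.derivative (Polynomial.derivative f)).eval x₀ = 0) := by
  have hp3 : 3 ≤ p := by
    have := hp.two_le
    omega
  have h2 : (2 : F) ≠ 0 := Ring.two_ne_zero (by rw [hchar]; exact hodd)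
  have ht : f.comp (Polynomial.C x₀ + Polynomial.X) = Polynomial.taylor x₀ f := by
    rw [Polynomial.taylor_apply, add_comm]
  have hd : (Polynomial.derivative (Polynomial.derivative f)).eval x₀
      = 2 * (Polynomial.taylor x₀ f).coeff 2 := by
    have h := Polynomial.factorial_smul_hasseDeriv (R := F) 2
    have h' := congrFun h f
    rw [Polynomial.taylor_coeff]
    have h'' := congrArg (Polynomial.eval x₀) h'
    simp at h''
    exact h''.symm
  rw [ht, hd]
  generalize hG : (-Polynomial.C ((Polynomial.derivative f).eval x₀ ^ p) * Polynomial.X ^ p +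
          Polynomial.C ((Polynomial.derivative f).eval x₀) * Polynomial.X +
          Polynomial.C (f.eval x₀) - Polynomial.taylor x₀ f) = G
  have c : ∀ n < 3, ((-Polynomial.C ((Polynomial.derivative f).eval x₀ ^ p) *
      Polynomial.X ^ p : Polynomial F)).coeff n = 0 := by
    intro n hn
    rw [← Polynomial.C_neg, Polynomial.coeff_C_mul_X_pow, if_neg (by omega)]
  have c0 : G.coeff 0 = 0 := by
    rw [← hG, Polynomial.coeff_sub, Polynomial.coeff_add, Polynomial.coeff_add, c 0 (by omega),
      Polynomial.taylor_coeff_zero]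
    simp
  have c1 : G.coeff 1 = 0 := by
    rw [← hG, Polynomial.coeff_sub, Polynomial.coeff_add, Polynomial.coeff_add, c 1 (by omega),
      Polynomial.taylor_coeff_one]
    simp [Polynomial.coeff_C]
  have c2 : G.coeff 2 = -(Polynomial.taylor x₀ f).coeff 2 := by
    rw [← hG, Polynomial.coeff_sub, Polynomial.coeff_add, Polynomial.coeff_add, c 2 (by omega)]
    simp [Polynomial.coeff_C, Polynomial.coeff_X]
  rw [Polynomial.X_pow_dvd_iff, Polynomial.X_pow_dvd_iff]
  refine ⟨?_, ?_, ?_⟩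
  · intro d hd
    interval_cases d <;> assumption
  · intro h
    have := h 2 (by omega)
    rw [c2, neg_eq_zero] at this
    rw [this, mul_zero]
  · intro h d hd
    have h3 := (mul_eq_zero.mp h).resolve_left h2
    interval_cases d
    · exact c0
    · exact c1
    · rw [c2, h3, neg_zero]
end
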